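/- Strategy composition under edge removal: let G be a finite SAS parity game, let v ∈ V1 be a Player-1 configuration with exactly two successors v_a and v_b, let G_a be the game G with the edge (v, v_b) removed, and let G_b be the game G with the edge (v, v_a) removed. If Player 0 has a winning strategy σ_a from a configuration u in G_a and a winning strategy σ_b from u in G_b, then Player 0 has a winning strategy from u in G (obtained by playing σ_a or σ_b according to whether the last move from v was to v_a or to v_b, each applied to the corresponding projected history). -/

import Mathlib

open MeasureTheory

/-- The set of elements occurring infinitely often in an infinite sequence. -/
def InfOcc {α : Type*} (s : ℕ → α) : Set α := {v | ∀ n, ∃ m, n ≤ m ∧ s m = v}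

/-- The minimal priority occurring infinitely often. -/
noncomputable def minPrio {α : Type*} (p : α → ℕ) (s : ℕ → α) : ℕ := sInf (p '' InfOcc s)

/-- The parity condition induced by a priority function. -/
def ParityWin {α : Type*} (p : α → ℕ) : Set (ℕ → α) := {s | Even (minPrio p s)}

/-- The history of a play up to (excluding) time `n`. -/
def hist {α : Type*} (p : ℕ → α) (n : ℕ) : List α := (List.range n).map p

/-- A finite stochastic game graph together with two priority functions:
`ps` inducing the sure parity condition and `pas` inducing the almost-sure one. -/
structure SASGame (V : Type) [Fintype V] where
  V0 : Set V
  V1 : Set V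
  Vp : Set V
  cover : V0 ∪ V1 ∪ Vp = Set.univ
  disj01 : Disjoint V0 V1
  disj0p : Disjoint V0 Vp
  disj1p : Disjoint V1 Vp
  E : V → V → Prop
  succ_nonempty : ∀ v, ∃ w, E v w
  κ : V → V → ENNReal
  κ_pos : ∀ v ∈ Vp, ∀ w, (0 < κ v w ↔ E v w)
  κ_sum : ∀ v ∈ Vp, ∑ w, κ v w = 1
  ps : V → ℕ
  pas : V → ℕ

variable {V : Type} [Fintype V]

/-- A strategy: given the past history and the current configuration, choose a successor. -/
abbrev Strat (V : Type) := List V → V → V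

/-- A valid Player-0 strategy respects the edge relation on Player-0 configurations. -/
def SASGame.Valid0 (G : SASGame V) (σ : Strat V) : Prop := ∀ h v, v ∈ G.V0 → G.E v (σ h v)

/-- A valid Player-1 strategy respects the edge relation on Player-1 configurations. -/
def SASGame.Valid1 (G : SASGame V) (π : Strat V) : Prop := ∀ h v, v ∈ G.V1 → G.E v (π h v)

/-- A strategy is memoryless if it only depends on the current configuration. -/
def Memoryless {V : Type} (σ : Strat V) : Prop := ∀ h h' v, σ h v = σ h' v

/-- `v(σ)`: the plays from `v` consistent with the Player-0 strategy `σ`. -/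
def SASGame.PlaysFrom (G : SASGame V) (v : V) (σ : Strat V) : Set (ℕ → V) :=
  {p | p 0 = v ∧ (∀ n, G.E (p n) (p (n + 1))) ∧
    ∀ n, p n ∈ G.V0 → p (n + 1) = σ (hist p n) (p n)}

/-- The plays from `v` consistent with both strategies `σ` and `π`. -/
def SASGame.Plays2 (G : SASGame V) (v : V) (σ π : Strat V) : Set (ℕ → V) :=
  {p | p ∈ G.PlaysFrom v σ ∧ ∀ n, p n ∈ G.V1 → p (n + 1) = π (hist p n) (p n)}

open Classical in
/-- One-step transition probability of the Markov chain `v(σ,π)`. -/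
noncomputable def SASGame.step (G : SASGame V) (σ π : Strat V)
    (past : List V) (cur nxt : V) : ENNReal :=
  if cur ∈ G.V0 then (if nxt = σ past cur then 1 else 0)
  else if cur ∈ G.V1 then (if nxt = π past cur then 1 else 0)
  else G.κ cur nxt

open Classical in
/-- Probability of the cylinder determined by the first `n+1` configurations of `h`. -/
noncomputable def SASGame.cylProb (G : SASGame V) (v : V) (σ π : Strat V)
    (h : ℕ → V) (n : ℕ) : ENNReal :=
  (if h 0 = v then 1 else 0) * ∏ i ∈ Finset.range n, G.step σ π (hist h i) (h i) (h (i + 1))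

/-- The product σ-algebra on plays. -/
def playMS (V : Type) : MeasurableSpace (ℕ → V) :=
  @MeasurableSpace.pi ℕ (fun _ => V) (fun _ => ⊤)

/-- `μ` is the probability measure of the Markov chain `v(σ,π)`: it is the (unique)
probability measure on plays assigning to every cylinder the product of the
transition probabilities along it. -/
def SASGame.IsPlayMeasure (G : SASGame V) (v : V) (σ π : Strat V)
    (μ : @Measure (ℕ → V) (playMS V)) : Prop :=
  μ Set.univ = 1 ∧
    ∀ (h : ℕ → V) (n : ℕ), μ {p | ∀ i ≤ n, p i = h i} = G.cylProb v σ π h n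

/-- Player 0 wins from `v` with strategy `σ`. -/
def SASGame.Wins0Via (G : SASGame V) (v : V) (σ : Strat V) : Prop :=
  G.Valid0 σ ∧ G.PlaysFrom v σ ⊆ ParityWin G.ps ∧
    ∀ π, G.Valid1 π → ∀ μ, G.IsPlayMeasure v σ π μ → μ (ParityWin G.pas) = 1

/-- Player 0 wins from `v`: she has a strategy `σ` such that all plays consistent with
`σ` satisfy the sure parity condition and, against every Player-1 strategy, the
almost-sure parity condition holds with probability 1. -/
def SASGame.Wins0 (G : SASGame V) (v : V) : Prop := ∃ σ, G.Wins0Via v σ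

/-- Player 1 wins from `v` with strategy `π`. -/
def SASGame.Wins1Via (G : SASGame V) (v : V) (π : Strat V) : Prop :=
  G.Valid1 π ∧ ∀ σ, G.Valid0 σ →
    (∃ p ∈ G.Plays2 v σ π, p ∉ ParityWin G.ps) ∨
    (∀ μ, G.IsPlayMeasure v σ π μ → μ (ParityWin G.pas) < 1)

/-- Player 1 wins from `v`. -/
def SASGame.Wins1 (G : SASGame V) (v : V) : Prop := ∃ π, G.Wins1Via v π

theorem hist_succ {α : Type*} (p : ℕ → α) (n : ℕ) : hist p (n + 1) = hist p n ++ [p n] := by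
  simp [hist, List.range_succ]

theorem length_hist {α : Type*} (p : ℕ → α) (n : ℕ) : (hist p n).length = n := by
  simp [hist]

theorem hist_congr {α : Type*} {p q : ℕ → α} {n : ℕ} (h : ∀ i < n, p i = q i) :
    hist p n = hist q n :=
  List.map_congr_left fun i hi => h i (List.mem_range.1 hi)

theorem hist_eq_ofFn {α : Type*} (p : ℕ → α) (n : ℕ) :
    hist p n = List.ofFn fun i : Fin n => p i := by
  apply List.ext_getElem <;> simp [hist]

/-- The past and the current configuration after `n` moves chosen by `c`, starting from `u`. -/
def runOf (c : List V → V → V) (u : V) : ℕ → List V × V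
  | 0 => ([], u)
  | n + 1 => ((runOf c u n).1 ++ [(runOf c u n).2], c (runOf c u n).1 (runOf c u n).2)

/-- The play from `u` in which every move is chosen by `c`. -/
def playOf (c : List V → V → V) (u : V) (n : ℕ) : V := (runOf c u n).2

theorem hist_playOf (c : List V → V → V) (u : V) (n : ℕ) :
    hist (playOf c u) n = (runOf c u n).1 := by
  induction n with
  | zero => rfl
  | succ n ih => rw [hist_succ, ih]; rfl

theorem playOf_zero (c : List V → V → V) (u : V) : playOf c u 0 = u := rfl

theorem playOf_succ (c : List V → V → V) (u : V) (n : ℕ) :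
    playOf c u (n + 1) = c (hist (playOf c u) n) (playOf c u n) := by
  rw [hist_playOf]; rfl

theorem playOf_agree_iff (c : List V → V → V) (u : V) (h : ℕ → V) (n : ℕ) :
    (∀ i ≤ n, playOf c u i = h i) ↔ h 0 = u ∧ ∀ i < n, h (i + 1) = c (hist h i) (h i) := by
  constructor
  · intro H
    refine ⟨(H 0 (Nat.zero_le _)).symm, fun i hi => ?_⟩
    rw [← H (i + 1) hi, playOf_succ, H i hi.le,
      hist_congr fun j hj => H j (hj.le.trans hi.le)]
  · rintro ⟨h0, H⟩ i
    induction i using Nat.strong_induction_on with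
    | _ i ih =>
      intro hi
      cases i with
      | zero => exact h0.symm
      | succ i =>
        rw [playOf_succ, H i hi, ih i (Nat.lt_succ_self i) (by omega),
          hist_congr fun j hj => ih j (by omega) (by omega)]

theorem eq_playOf {c : List V → V → V} {u : V} {p : ℕ → V} (h0 : p 0 = u)
    (hs : ∀ n, p (n + 1) = c (hist p n) (p n)) : playOf c u = p :=
  funext fun n => (playOf_agree_iff c u p n).2 ⟨h0, fun i _ => hs i⟩ n le_rfl

theorem SASGame.mem_cases (G : SASGame V) (x : V) :
    x ∈ G.V0 ∨ (x ∉ G.V0 ∧ x ∈ G.V1) ∨ (x ∉ G.V0 ∧ x ∉ G.V1 ∧ x ∈ G.Vp) := by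
  have : x ∈ G.V0 ∪ G.V1 ∪ G.Vp := by rw [G.cover]; trivial
  simp only [Set.mem_union] at this
  tauto

open Classical in
/-- The move prescribed by the strategies `σ` and `π`, with `f` resolving the probabilistic
configurations. -/
noncomputable def SASGame.move (G : SASGame V) (σ π f : Strat V) : Strat V := fun h x =>
  if x ∈ G.V0 then σ h x else if x ∈ G.V1 then π h x else f h x

open Classical in
/-- The distribution `κ x`, replaced by a point mass where `κ x` is not a distribution. -/
noncomputable def transLaw (κ : V → V → ENNReal) (x : V) : PMF V :=
  if h : ∑ y, κ x y = 1 then PMF.ofFintype (κ x) h else PMF.pure x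

theorem SASGame.transLaw_apply (G : SASGame V) {x : V} (hx : x ∈ G.Vp) (y : V) :
    transLaw G.κ x y = G.κ x y := by
  rw [transLaw, dif_pos (G.κ_sum x hx), PMF.ofFintype_apply]

/-- The variables `X i` are independent under `Q`, and `X i` has the law of a transition
from `loc i`. -/
def IsSampler {Ω I : Type*} [MeasurableSpace Ω] [MeasurableSpace V] (κ : V → V → ENNReal)
    (Q : Measure Ω) (loc : I → V) (X : I → Ω → V) : Prop :=
  (∀ i, Measurable (X i)) ∧
    ∀ (S : Finset I) (c : I → V), Q {ω | ∀ s ∈ S, X s ω = c s} = ∏ s ∈ S, transLaw κ (loc s) (c s)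

/-- The product measure that samples a transition for every history. -/
noncomputable def sampleMeasure [MeasurableSpace V] (κ : V → V → ENNReal) :
    Measure (List V × V → V) :=
  Measure.infinitePi fun i => (transLaw κ i.2).toMeasure

instance [MeasurableSpace V] (κ : V → V → ENNReal) : IsProbabilityMeasure (sampleMeasure κ) := by
  unfold sampleMeasure; infer_instance

section Sampling

variable [mV : MeasurableSpace V] [DiscreteMeasurableSpace V]

theorem isSampler_sampleMeasure (κ : V → V → ENNReal) :
    IsSampler κ (sampleMeasure κ) Prod.snd fun i ω => ω i := by
  refine ⟨fun i => measurable_pi_apply i, fun S c => ?_⟩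
  have : {ω : List V × V → V | ∀ s ∈ S, ω s = c s} = Set.pi S fun s => {c s} := by
    ext ω; simp [Set.mem_pi]
  rw [this, sampleMeasure, Measure.infinitePi_pi _ fun i _ => MeasurableSet.of_discrete]
  exact Finset.prod_congr rfl fun s _ => PMF.toMeasure_apply_singleton _ _ .of_discrete

variable {Ω I : Type*} [MeasurableSpace Ω] {κ : V → V → ENNReal} {Q : Measure Ω} {loc : I → V}
  {X : I → Ω → V}

theorem IsSampler.measure_univ (hX : IsSampler κ Q loc X) : Q Set.univ = 1 := by
  by_cases hV : Nonempty V
  · obtain ⟨v⟩ := hV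
    simpa using hX.2 ∅ fun _ => v
  · have hI : IsEmpty I ∨ IsEmpty Ω := by
      by_contra h
      push Not at h
      obtain ⟨⟨i⟩, ⟨ω⟩⟩ := h
      exact hV ⟨X i ω⟩
    rcases hI with hI | hI
    · simpa using hX.2 ∅ hI.elim
    · by_cases hI' : IsEmpty I
      · simpa using hX.2 ∅ hI'.elim
      · rw [not_isEmpty_iff] at hI'
        exact (hV ⟨loc hI'.some⟩).elim

theorem IsSampler.measure_cylinder (G : SASGame V) (hX : IsSampler G.κ Q loc X)
    {J : List V → V → I} (hloc : ∀ h, ∀ x ∈ G.Vp, loc (J h x) = x)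
    (hJ : ∀ (p : ℕ → V) (m n : ℕ), m < n → p m ∈ G.Vp → p n ∈ G.Vp →
      J (hist p m) (p m) ≠ J (hist p n) (p n))
    (u : V) (σ π : Strat V) (h : ℕ → V) (n : ℕ) :
    Q {ω | ∀ i ≤ n, playOf (G.move σ π fun l x => X (J l x) ω) u i = h i} =
      G.cylProb u σ π h n := by
  classical
  simp only [playOf_agree_iff]
  by_cases h0 : h 0 = u
  swap
  · simp [h0, SASGame.cylProb]
  by_cases det : ∀ i < n, h i ∉ G.Vp → h (i + 1) = G.move σ π (fun _ x => x) (hist h i) (h i)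
  · let j : ℕ → I := fun i => J (hist h i) (h i)
    have hj : ∀ i i', h i ∈ G.Vp → h i' ∈ G.Vp → j i = j i' → i = i' := by
      intro i i' hi hi' e
      rcases lt_trichotomy i i' with lt | eq | gt
      · exact (hJ h i i' lt hi hi' e).elim
      · exact eq
      · exact (hJ h i' i gt hi' hi e.symm).elim
    obtain ⟨c, hc⟩ : ∃ c : I → V, ∀ i, h i ∈ G.Vp → c (j i) = h (i + 1) := by
      refine ⟨fun s => if hs : ∃ i, h i ∈ G.Vp ∧ j i = s then h (hs.choose + 1) else u,
        fun i hi => ?_⟩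
      have hs : ∃ i', h i' ∈ G.Vp ∧ j i' = j i := ⟨i, hi, rfl⟩
      simp only [dif_pos hs]
      rw [hj _ _ hs.choose_spec.1 hi hs.choose_spec.2]
    let T := (Finset.range n).filter fun i => h i ∈ G.Vp
    have hset : {ω | h 0 = u ∧ ∀ i < n, h (i + 1) =
        G.move σ π (fun l x => X (J l x) ω) (hist h i) (h i)} =
        {ω | ∀ s ∈ T.image j, X s ω = c s} := by
      ext ω
      simp only [Set.mem_ofPred_eq, h0, true_and, Finset.forall_mem_image, T, Finset.mem_filter,
        Finset.mem_range, and_imp]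
      refine forall₂_congr fun i hi => ?_
      rcases G.mem_cases (h i) with hm | ⟨hm, hm'⟩ | ⟨hm, hm', hm''⟩
      · have hp : h i ∉ G.Vp := fun hp => Set.disjoint_left.1 G.disj0p hm hp
        simpa [hp, SASGame.move, hm] using det i hi hp
      · have hp : h i ∉ G.Vp := fun hp => Set.disjoint_left.1 G.disj1p hm' hp
        simpa [hp, SASGame.move, hm, hm'] using det i hi hp
      · simp only [SASGame.move, hm, hm', if_false, hm'', true_imp_iff, hc i hm'', j]
        exact eq_comm
    rw [hset, hX.2, Finset.prod_image, SASGame.cylProb, if_pos h0, one_mul, Finset.prod_filter]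
    · refine Finset.prod_congr rfl fun i hi => ?_
      have hi := Finset.mem_range.1 hi
      rcases G.mem_cases (h i) with hm | ⟨hm, hm'⟩ | ⟨hm, hm', hm''⟩
      · have hp : h i ∉ G.Vp := fun hp => Set.disjoint_left.1 G.disj0p hm hp
        have := det i hi hp
        simp only [SASGame.move, hm, if_true] at this
        simp [hp, SASGame.step, hm, this]
      · have hp : h i ∉ G.Vp := fun hp => Set.disjoint_left.1 G.disj1p hm' hp
        have := det i hi hp
        simp only [SASGame.move, hm, hm', if_true, if_false] at this
        simp [hp, SASGame.step, hm, hm', this]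
      · rw [if_pos hm'', hc i hm'']
        simp only [SASGame.step, hm, hm', if_false, j]
        rw [hloc _ _ hm'', G.transLaw_apply hm'']
    · intro i hi i' hi' e
      exact hj i i' (Finset.mem_filter.1 hi).2 (Finset.mem_filter.1 hi').2 e
  · push Not at det
    obtain ⟨i, hi, hp, hne⟩ := det
    have hstep : G.step σ π (hist h i) (h i) (h (i + 1)) = 0 ∧
        ∀ ω, h (i + 1) ≠ G.move σ π (fun l x => X (J l x) ω) (hist h i) (h i) := by
      rcases G.mem_cases (h i) with hm | ⟨hm, hm'⟩ | ⟨hm, hm', hm''⟩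
      · simp only [SASGame.move, hm, if_true] at hne
        simp [SASGame.step, SASGame.move, hm, hne]
      · simp only [SASGame.move, hm, hm', if_true, if_false] at hne
        simp [SASGame.step, SASGame.move, hm, hm', hne]
      · exact (hp hm'').elim
    rw [SASGame.cylProb, Finset.prod_eq_zero (Finset.mem_range.2 hi) hstep.1, mul_zero]
    convert measure_empty (μ := Q)
    ext ω
    simp only [Set.mem_ofPred_eq, Set.mem_empty_iff_false, iff_false]
    exact fun H => hstep.2 ω (H.2 i hi)

theorem measurableSet_cylinder (h : ℕ → V) (n : ℕ) :
    MeasurableSet {p : ℕ → V | ∀ i ≤ n, p i = h i} := by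
  have : {p : ℕ → V | ∀ i ≤ n, p i = h i} = ⋂ i ∈ Set.Iic n, (fun p => p i) ⁻¹' {h i} := by
    ext; simp
  rw [this]
  exact MeasurableSet.biInter (Set.to_countable _) fun i _ =>
    measurable_pi_apply i MeasurableSet.of_discrete

theorem measurableSet_hist (n : ℕ) (Φ : List V → Prop) :
    MeasurableSet {p : ℕ → V | Φ (hist p n)} := by
  have hm : Measurable fun (p : ℕ → V) (i : Fin n) => p i :=
    measurable_pi_lambda _ fun i => measurable_pi_apply _
  have : {p : ℕ → V | Φ (hist p n)} =
      (fun (p : ℕ → V) (i : Fin n) => p i) ⁻¹' {f | Φ (List.ofFn f)} := by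
    ext p; simp [hist_eq_ofFn]
  rw [this]
  exact hm (Set.toFinite _).measurableSet

theorem generateFrom_cylinder :
    (MeasurableSpace.pi : MeasurableSpace (ℕ → V)) =
      .generateFrom {s | ∃ (h : ℕ → V) (n : ℕ), s = {p | ∀ i ≤ n, p i = h i}} := by
  refine le_antisymm (iSup_le fun n => ?_) (MeasurableSpace.generateFrom_le ?_)
  swap
  · rintro s ⟨h, n, rfl⟩
    exact measurableSet_cylinder h n
  rw [← measurable_iff_comap_le]
  refine @measurable_to_countable' _ _ _ _ (MeasurableSpace.generateFrom _) _ fun x => ?_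
  have : (fun p : ℕ → V => p n) ⁻¹' {x} = ⋃ (f : Fin (n + 1) → V) (_ : f (Fin.last n) = x),
      {p | ∀ i ≤ n, p i = if hi : i < n + 1 then f ⟨i, hi⟩ else x} := by
    ext p
    simp only [Set.mem_preimage, Set.mem_singleton_iff, Set.mem_iUnion, Set.mem_ofPred_eq,
      exists_prop]
    constructor
    · rintro rfl
      refine ⟨fun i => p i, rfl, fun i hi => ?_⟩
      rw [dif_pos (Nat.lt_succ_of_le hi)]
    · rintro ⟨f, rfl, hf⟩
      rw [hf n le_rfl, dif_pos (Nat.lt_succ_self n)]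
      rfl
  rw [this]
  refine MeasurableSet.iUnion fun f => MeasurableSet.iUnion fun _ => ?_
  exact MeasurableSpace.measurableSet_generateFrom ⟨_, n, rfl⟩

theorem ext_of_cylinder {μ ν : Measure (ℕ → V)} [IsFiniteMeasure μ]
    (huniv : μ Set.univ = ν Set.univ)
    (H : ∀ (h : ℕ → V) (n : ℕ), μ {p | ∀ i ≤ n, p i = h i} = ν {p | ∀ i ≤ n, p i = h i}) :
    μ = ν := by
  refine ext_of_generate_finite _ generateFrom_cylinder ?_ ?_ huniv
  · rintro s ⟨h, n, rfl⟩ t ⟨h', n', rfl⟩ ⟨p, hp, hp'⟩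
    refine ⟨p, max n n', ?_⟩
    ext q
    simp only [Set.mem_inter_iff, Set.mem_ofPred_eq] at hp hp' ⊢
    constructor
    · rintro ⟨h1, h2⟩ i hi
      rcases le_max_iff.1 hi with hi | hi
      · rw [h1 i hi, hp i hi]
      · rw [h2 i hi, hp' i hi]
    · intro h1
      exact ⟨fun i hi => by rw [h1 i (le_max_of_le_left hi), hp i hi],
        fun i hi => by rw [h1 i (le_max_of_le_right hi), hp' i hi]⟩
  · rintro s ⟨h, n, rfl⟩
    exact H h n

theorem measurable_playOf_move (G : SASGame V) (hX : IsSampler κ Q loc X) (J : List V → V → I)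
    (u : V) (σ π : Strat V) :
    Measurable fun ω => playOf (G.move σ π fun l x => X (J l x) ω) u := by
  classical
  rw [generateFrom_cylinder]
  refine measurable_generateFrom ?_
  rintro s ⟨h, n, rfl⟩
  simp only [Set.preimage_ofPred_eq, playOf_agree_iff, measurableSet_setOfPred]
  refine Measurable.and measurable_const (Measurable.forall fun i => Measurable.forall fun _ => ?_)
  rw [← measurableSet_setOfPred]
  unfold SASGame.move
  split_ifs
  · exact MeasurableSet.const _
  · exact MeasurableSet.const _
  · simp only [eq_comm (a := h (i + 1))]
    exact hX.1 _ (MeasurableSet.of_discrete (s := {h (i + 1)}))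

/-- If the predicates `D n x` are measurable, so is every property of the set of those `x` for
which `D n x` holds for infinitely many `n`. -/
theorem measurableSet_infinitelyOften {D : ℕ → V → Set Ω} (hD : ∀ n x, MeasurableSet (D n x))
    (Φ : Set V → Prop) : MeasurableSet {ω | Φ {x | ∀ N, ∃ n, N ≤ n ∧ ω ∈ D n x}} := by
  have hm : Measurable fun ω => {x | ∀ N, ∃ n, N ≤ n ∧ ω ∈ D n x} := by
    refine measurable_set_iff.2 fun x => ?_
    simp only [Set.mem_ofPred_eq]
    refine Measurable.forall fun N => Measurable.exists fun n => ?_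
    exact measurable_const.and (measurableSet_setOfPred.1 (hD n x))
  exact hm (Set.toFinite {A | Φ A}).measurableSet

theorem measurableSet_parityWin (f : V → ℕ) : MeasurableSet (ParityWin f) := by
  refine measurableSet_infinitelyOften (D := fun n x => {p : ℕ → V | p n = x})
    (fun n x => ?_) fun A => Even (sInf (f '' A))
  exact (measurable_pi_apply n : Measurable fun p : ℕ → V => p n)
    (MeasurableSet.of_discrete (s := {x}))

theorem IsSampler.forall_isPlayMeasure_iff (G : SASGame V) (hX : IsSampler G.κ Q loc X)
    {J : List V → V → I} (hloc : ∀ h, ∀ x ∈ G.Vp, loc (J h x) = x)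
    (hJ : ∀ (p : ℕ → V) (m n : ℕ), m < n → p m ∈ G.Vp → p n ∈ G.Vp →
      J (hist p m) (p m) ≠ J (hist p n) (p n))
    (u : V) (σ π : Strat V) :
    (∀ μ, G.IsPlayMeasure u σ π μ → μ (ParityWin G.pas) = 1) ↔
      ∀ᵐ ω ∂Q, playOf (G.move σ π fun l x => X (J l x) ω) u ∈ ParityWin G.pas := by
  obtain rfl : mV = ⊤ := eq_top_iff.2 fun s _ => MeasurableSet.of_discrete
  let _ : MeasurableSpace V := ⊤
  have : IsProbabilityMeasure Q := ⟨hX.measure_univ⟩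
  have hm := measurable_playOf_move G hX J u σ π
  set F : Ω → ℕ → V := fun ω => playOf (G.move σ π fun l x => X (J l x) ω) u with hF
  have hprob : IsProbabilityMeasure (Q.map F) := Measure.isProbabilityMeasure_map hm.aemeasurable
  have hlaw : ∀ (h : ℕ → V) (n : ℕ),
      Q.map F {p | ∀ i ≤ n, p i = h i} = G.cylProb u σ π h n := by
    intro h n
    rw [Measure.map_apply hm (measurableSet_cylinder h n)]
    exact hX.measure_cylinder G hloc hJ u σ π h n
  have hplay : G.IsPlayMeasure u σ π (Q.map F) := ⟨hprob.measure_univ, hlaw⟩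
  have hW := measurableSet_parityWin G.pas
  have hiff : Q.map F (ParityWin G.pas) = 1 ↔ ∀ᵐ ω ∂Q, F ω ∈ ParityWin G.pas := by
    rw [← prob_compl_eq_zero_iff hW, Measure.map_apply hm hW.compl]
    rfl
  rw [← hiff]
  refine ⟨fun H => H _ hplay, fun H μ hμ => ?_⟩
  have : Q.map F = μ := by
    refine ext_of_cylinder (hprob.measure_univ.trans hμ.1.symm) fun h n => ?_
    exact (hlaw h n).trans (hμ.2 h n).symm
  rw [← this]
  exact H

end Sampling

theorem hist_succ_eq_cons {α : Type*} (p : ℕ → α) (n : ℕ) :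
    hist p (n + 1) = p 0 :: hist (fun i => p (i + 1)) n := by
  simp [hist, List.range_succ_eq_map, Function.comp_def]

theorem infOcc_tail {α : Type*} (p : ℕ → α) : InfOcc (fun i => p (i + 1)) = InfOcc p := by
  ext x
  constructor
  · intro h n
    obtain ⟨m, hm, rfl⟩ := h n
    exact ⟨m + 1, by omega, rfl⟩
  · intro h n
    obtain ⟨m, hm, rfl⟩ := h (n + 1)
    exact ⟨m - 1, by omega, by simp only [Nat.sub_add_cancel (show 1 ≤ m by omega)]⟩

theorem tail_mem_parityWin_iff {α : Type*} {f : α → ℕ} {p : ℕ → α} :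
    (fun i => p (i + 1)) ∈ ParityWin f ↔ p ∈ ParityWin f := by
  simp only [ParityWin, minPrio, Set.mem_ofPred_eq, infOcc_tail]

theorem SASGame.Valid0.playOf_mem {G : SASGame V} {σ π f : Strat V} (hσ : G.Valid0 σ)
    (hπ : G.Valid1 π) (hf : ∀ h, ∀ x ∈ G.Vp, G.E x (f h x)) (u : V) :
    playOf (G.move σ π f) u ∈ G.PlaysFrom u σ := by
  refine ⟨rfl, fun n => ?_, fun n hn => ?_⟩
  · rw [playOf_succ]
    unfold SASGame.move
    split_ifs with h0 h1
    · exact hσ _ _ h0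
    · exact hπ _ _ h1
    · rcases G.mem_cases (playOf (G.move σ π f) u n) with h | h | h
      · exact (h0 h).elim
      · exact (h1 h.2).elim
      · exact hf _ _ h.2.2
  · rw [playOf_succ]
    simp only [SASGame.move] at hn ⊢
    rw [if_pos hn]

section Sampling

variable [MeasurableSpace V] [DiscreteMeasurableSpace V]

theorem SASGame.forall_isPlayMeasure_iff (G : SASGame V) (u : V) (σ π : Strat V) :
    (∀ μ, G.IsPlayMeasure u σ π μ → μ (ParityWin G.pas) = 1) ↔
      ∀ᵐ ω ∂sampleMeasure G.κ,
        playOf (G.move σ π fun l x => ω (l, x)) u ∈ ParityWin G.pas := by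
  refine (isSampler_sampleMeasure G.κ).forall_isPlayMeasure_iff G
    (J := fun l x => (l, x)) (fun _ _ _ => rfl) (fun p m n hmn _ _ h => ?_) u σ π
  have := congrArg (fun s => s.1.length) h
  simp only [length_hist] at this
  omega

theorem sampleMeasure_eval (κ : V → V → ENNReal) (i : List V × V) (y : V) :
    sampleMeasure κ {ω | ω i = y} = transLaw κ i.2 y := by
  simpa using (isSampler_sampleMeasure κ).2 {i} fun _ => y

theorem SASGame.ae_sampleMeasure_edge (G : SASGame V) :
    ∀ᵐ ω ∂sampleMeasure G.κ, ∀ l, ∀ x ∈ G.Vp, G.E x (ω (l, x)) := by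
  rw [ae_all_iff]
  intro l
  rw [ae_all_iff]
  intro x
  by_cases hx : x ∈ G.Vp
  swap
  · exact .of_forall fun _ h => (hx h).elim
  have : ∀ y, ¬ G.E x y → ∀ᵐ ω ∂sampleMeasure G.κ, ω (l, x) ≠ y := by
    intro y hy
    have := sampleMeasure_eval G.κ (l, x) y
    rw [G.transLaw_apply hx, not_not.1 (fun h => hy ((G.κ_pos x hx y).1 (pos_iff_ne_zero.2 h)))]
      at this
    simpa [ae_iff] using this
  filter_upwards [ae_all_iff.2 fun y => Filter.eventually_imp_distrib_left.2 (this y)] with ω hω _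
  exact by_contra fun h => hω _ h rfl

end Sampling

theorem SASGame.Wins0Via.tail {G : SASGame V} {u x : V} {σ : Strat V} (h : G.Wins0Via u σ)
    (hE : G.E u x) (hσ : u ∈ G.V0 → x = σ [] u) : G.Wins0Via x fun l y => σ (u :: l) y := by
  classical
  refine ⟨fun l y hy => h.1 _ y hy, ?_, fun π hπ => ?_⟩
  · rintro p ⟨rfl, hp, hp0⟩
    let q : ℕ → V := fun n => n.casesOn u p
    have hq : q ∈ G.PlaysFrom u σ := by
      refine ⟨rfl, fun n => ?_, fun n hn => ?_⟩
      · cases n with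
        | zero => exact hE
        | succ n => exact hp n
      · cases n with
        | zero => exact hσ hn
        | succ n =>
          rw [hist_succ_eq_cons]
          exact hp0 n hn
    exact tail_mem_parityWin_iff.2 (h.2.1 hq)
  let _ : MeasurableSpace V := ⊤
  let π' : Strat V := fun l y => l.casesOn (if y = u then x else π [] y) fun _ l => π l y
  have hπ' : G.Valid1 π' := by
    intro l y hy
    cases l with
    | nil =>
      change G.E y (if y = u then x else π [] y)
      split_ifs with e
      · exact e ▸ hE
      · exact hπ _ _ hy
    | cons z l => exact hπ _ _ hy
  obtain ⟨y, hy0, hy⟩ : ∃ y, transLaw G.κ u y ≠ 0 ∧ (u ∈ G.Vp → y = x) := by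
    by_cases hu : u ∈ G.Vp
    · refine ⟨x, ?_, fun _ => rfl⟩
      rw [G.transLaw_apply hu]
      exact ((G.κ_pos u hu x).2 hE).ne'
    · obtain ⟨y, hy⟩ := (transLaw G.κ u).support_nonempty
      exact ⟨y, hy, fun h => (hu h).elim⟩
  let P := sampleMeasure G.κ
  let B : Set (List V × V → V) := {ω | ω ([], u) = y}
  have hB : MeasurableSet B := (measurable_pi_apply ([], u) : Measurable fun ω : List V × V → V =>
    ω ([], u)) (MeasurableSet.of_discrete (s := {y}))
  have hPB : P B = transLaw G.κ u y := sampleMeasure_eval G.κ ([], u) y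
  have hX : IsSampler G.κ (ProbabilityTheory.cond P B) Prod.snd
      fun (i : List V × V) ω => ω (u :: i.1, i.2) := by
    refine ⟨fun i => measurable_pi_apply _, fun S c => ?_⟩
    let e : List V × V → List V × V := fun i => (u :: i.1, i.2)
    let c' : List V × V → V := fun i => i.1.casesOn y fun _ l => c (l, i.2)
    have hset : B ∩ {ω | ∀ s ∈ S, ω (u :: s.1, s.2) = c s} =
        {ω | ∀ s ∈ insert ([], u) (S.image e), ω s = c' s} := by
      ext ω
      simp only [Set.mem_inter_iff, Set.mem_ofPred_eq, Finset.forall_mem_insert,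
        Finset.forall_mem_image, B]
      rfl
    have hnot : ([], u) ∉ S.image e := by simp [e]
    have hinj : Set.InjOn e S := by
      rintro ⟨l, a⟩ - ⟨l', a'⟩ - h
      simpa [e] using h
    rw [ProbabilityTheory.cond_apply hB, hset, (isSampler_sampleMeasure G.κ).2,
      Finset.prod_insert hnot, Finset.prod_image hinj, ← mul_assoc, hPB]
    change (transLaw G.κ u y)⁻¹ * transLaw G.κ u y * _ = _
    rw [ENNReal.inv_mul_cancel hy0 (PMF.apply_ne_top _ _), one_mul]
  refine (hX.forall_isPlayMeasure_iff G (J := fun l x => (l, x)) (fun _ _ _ => rfl)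
    (fun p m n hmn _ _ h => ?_) x _ π).2 ?_
  · have := congrArg (fun s => s.1.length) h
    simp only [length_hist] at this
    omega
  have hae := (G.forall_isPlayMeasure_iff u σ π').1 (h.2.2 π' hπ')
  filter_upwards [ProbabilityTheory.cond_absolutelyContinuous.ae_le hae,
    ProbabilityTheory.ae_cond_mem hB] with ω hω hωB
  rw [← tail_mem_parityWin_iff] at hω
  convert hω using 1
  refine eq_playOf ?_ fun n => ?_
  · rw [playOf_succ, playOf_zero]
    rcases G.mem_cases u with hu | ⟨hu, hu'⟩ | ⟨hu, hu', hu''⟩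
    · simp [SASGame.move, hu, hσ hu, hist]
    · simp [SASGame.move, hu, hu', hist, π']
    · simp only [SASGame.move, hu, hu', if_false]
      exact hωB.trans (hy hu'')
  · rw [playOf_succ, hist_succ_eq_cons, playOf_zero]
    rfl

/-- `G.Reaches u σ x τ`: some history from `u` consistent with `σ` leads to `x`, where `τ` is the
strategy that continues `σ` after this history. -/
inductive SASGame.Reaches (G : SASGame V) : V → Strat V → V → Strat V → Prop
  | refl (u : V) (σ : Strat V) : G.Reaches u σ u σ
  | head {u y x : V} {σ τ : Strat V} (hE : G.E u y) (hσ : u ∈ G.V0 → y = σ [] u)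
      (h : G.Reaches y (fun l z => σ (u :: l) z) x τ) : G.Reaches u σ x τ

theorem SASGame.Reaches.wins0Via {G : SASGame V} {u x : V} {σ τ : Strat V}
    (h : G.Reaches u σ x τ) (hw : G.Wins0Via u σ) : G.Wins0Via x τ := by
  induction h with
  | refl => exact hw
  | head hE hσ _ ih => exact ih (hw.tail hE hσ)

theorem SASGame.exists_reaches (G : SASGame V) (n : ℕ) : ∀ (p : ℕ → V) (σ : Strat V),
    (∀ i < n, G.E (p i) (p (i + 1))) →
    (∀ i < n, p i ∈ G.V0 → p (i + 1) = σ (hist p i) (p i)) → ∃ τ, G.Reaches (p 0) σ (p n) τ := by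
  induction n with
  | zero => exact fun p σ _ _ => ⟨σ, .refl _ _⟩
  | succ n ih =>
    intro p σ hE hσ
    obtain ⟨τ, hτ⟩ := ih (fun i => p (i + 1)) (fun l z => σ (p 0 :: l) z)
      (fun i hi => hE (i + 1) (by omega)) fun i hi h0 => by
        have := hσ (i + 1) (by omega) h0
        rwa [hist_succ_eq_cons] at this
    exact ⟨τ, .head (hE 0 (by omega)) (hσ 0 (by omega)) hτ⟩

/-- `H` is the game `G` with the edge from `v` to `z` removed. -/
structure EdgeRemoved (G H : SASGame V) (v z : V) : Prop where
  V0_eq : H.V0 = G.V0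
  V1_eq : H.V1 = G.V1
  κ_eq : H.κ = G.κ
  ps_eq : H.ps = G.ps
  pas_eq : H.pas = G.pas
  E_iff : ∀ x y, H.E x y ↔ G.E x y ∧ ¬(x = v ∧ y = z)

theorem EdgeRemoved.E_iff_of_ne {G H : SASGame V} {v z x y : V} (hH : EdgeRemoved G H v z)
    (hx : x ≠ v) : H.E x y ↔ G.E x y := by
  simp [hH.E_iff, hx]

theorem EdgeRemoved.move_eq {G H : SASGame V} {v z : V} (hH : EdgeRemoved G H v z) :
    H.move = G.move := by
  funext σ π f h x
  unfold SASGame.move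
  congr 1
  · rw [hH.V0_eq]
  · congr 1
    rw [hH.V1_eq]

theorem EdgeRemoved.wins0Via_of_not_reaches {G H : SASGame V} {u v z : V} {σ : Strat V}
    (hH : EdgeRemoved G H v z) (hw : H.Wins0Via u σ) (hv : ∀ τ, ¬ H.Reaches u σ v τ) :
    G.Wins0Via u σ := by
  classical
  have hσ : G.Valid0 σ := fun l x hx => ((hH.E_iff _ _).1 (hw.1 l x (hH.V0_eq ▸ hx))).1
  have hne : ∀ p ∈ G.PlaysFrom u σ, ∀ n, p n ≠ v := by
    rintro p ⟨rfl, hE, h0⟩ n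
    induction n using Nat.strong_induction_on with
    | _ n ih =>
      intro hn
      obtain ⟨τ, hτ⟩ := H.exists_reaches n p σ
        (fun i hi => (hH.E_iff_of_ne (ih i hi)).2 (hE i)) fun i _ hi => h0 i (hH.V0_eq ▸ hi)
      exact hv τ (hn ▸ hτ)
  refine ⟨hσ, fun p hp => ?_, fun π hπ => ?_⟩
  · have : p ∈ H.PlaysFrom u σ :=
      ⟨hp.1, fun n => (hH.E_iff_of_ne (hne p hp n)).2 (hp.2.1 n),
        fun n hn => hp.2.2 n (hH.V0_eq ▸ hn)⟩
    exact hH.ps_eq ▸ hw.2.1 this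
  · let _ : MeasurableSpace V := ⊤
    obtain ⟨z', hz'⟩ := H.succ_nonempty v
    let π' : Strat V := fun l x => if x = v then z' else π l x
    have hπ' : H.Valid1 π' := by
      intro l x hx
      by_cases e : x = v
      · simpa [π', e] using hz'
      · simpa [π', e, hH.E_iff] using hπ l x (hH.V1_eq ▸ hx)
    have hae := (H.forall_isPlayMeasure_iff u σ π').1 (hw.2.2 π' hπ')
    rw [hH.pas_eq, hH.κ_eq, hH.move_eq] at hae
    rw [G.forall_isPlayMeasure_iff]
    filter_upwards [hae, G.ae_sampleMeasure_edge] with ω hω hE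
    convert hω using 1
    refine (eq_playOf rfl fun n => ?_).symm
    have hn := hne _ (hσ.playOf_mem hπ (f := fun l x => ω (l, x)) hE u) n
    rw [playOf_succ]
    simp only [SASGame.move, π', if_neg hn] at hn ⊢

/-- The bookkeeping of the composed strategy: the index of the game being played and the past of
each of the two games. Leaving `v` selects the game, according to whether the move is to `z`. -/
noncomputable def shiftState (v z : V) (S : Bool × (Bool → List V)) (x y : V) :
    Bool × (Bool → List V) :=
  open Classical in
  let m := if x = v then decide (y = z) else S.1
  (m, Function.update S.2 m (S.2 m ++ [x]))

/-- The bookkeeping state after the reversed past and the current configuration. -/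
noncomputable def projState (v z : V) : List V → V → Bool × (Bool → List V)
  | [], _ => (false, fun _ => [])
  | y :: l, x => shiftState v z (projState v z l y) y x

/-- The bookkeeping state at time `n` of a play. -/
noncomputable def stateAt (v z : V) (p : ℕ → V) (n : ℕ) : Bool × (Bool → List V) :=
  projState v z (hist p n).reverse (p n)

/-- The move made at time `n` belongs to game `t`. -/
def Adv (v z : V) (t : Bool) (p : ℕ → V) (n : ℕ) : Prop := (stateAt v z p (n + 1)).1 = t

open Classical in
/-- The current configuration of game `t` at time `n`. -/
noncomputable def curAt (v z : V) (t : Bool) (p : ℕ → V) (n : ℕ) : V :=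
  if (stateAt v z p n).1 = t then p n else v

/-- The history of game `t` at time `n`, including the current configuration. -/
noncomputable def traceAt (v z : V) (t : Bool) (p : ℕ → V) (n : ℕ) : List V :=
  (stateAt v z p n).2 t ++ [curAt v z t p n]

/-- The configurations left infinitely often by a move that belongs to game `t`. -/
def advOcc (v z : V) (t : Bool) (p : ℕ → V) : Set V :=
  {x | ∀ N, ∃ n, N ≤ n ∧ p ∈ {p | Adv v z t p n ∧ p n = x}}

section Projection

variable {v z : V} {t : Bool} {p q : ℕ → V} {n : ℕ}

theorem stateAt_succ : stateAt v z p (n + 1) =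
    shiftState v z (stateAt v z p n) (p n) (p (n + 1)) := by
  simp [stateAt, hist_succ, projState]

theorem stateAt_congr (h : ∀ i ≤ n, p i = q i) : stateAt v z p n = stateAt v z q n := by
  rw [stateAt, stateAt, hist_congr fun i hi => h i hi.le, h n le_rfl]

theorem adv_iff_of_ne (h : p n ≠ v) : Adv v z t p n ↔ (stateAt v z p n).1 = t := by
  simp [Adv, stateAt_succ, shiftState, h]

theorem adv_iff_of_eq (h : p n = v) : Adv v z t p n ↔ (p (n + 1) = z ↔ t = true) := by
  cases t <;> simp [Adv, stateAt_succ, shiftState, h]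

theorem stateAt_snd_succ_of_adv (h : Adv v z t p n) :
    (stateAt v z p (n + 1)).2 t = (stateAt v z p n).2 t ++ [p n] := by
  unfold Adv at h
  rw [stateAt_succ] at h ⊢
  simp only [shiftState] at h ⊢
  rw [h, Function.update_self]

theorem stateAt_snd_succ_of_not_adv (h : ¬ Adv v z t p n) :
    (stateAt v z p (n + 1)).2 t = (stateAt v z p n).2 t := by
  unfold Adv at h
  rw [stateAt_succ] at h ⊢
  simp only [shiftState] at h ⊢
  rw [Function.update_of_ne (Ne.symm h)]

theorem curAt_of_adv (h : Adv v z t p n) : curAt v z t p n = p n := by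
  by_cases hv : p n = v
  · simp [curAt, hv]
  · rw [curAt, if_pos ((adv_iff_of_ne hv).1 h)]

theorem curAt_succ_of_adv (h : Adv v z t p n) : curAt v z t p (n + 1) = p (n + 1) := if_pos h

theorem curAt_of_not_adv (h : ¬ Adv v z t p n) : curAt v z t p n = v := by
  by_cases hv : p n = v
  · simp [curAt, hv]
  · rw [curAt, if_neg (mt (adv_iff_of_ne hv).2 h)]

theorem curAt_succ_of_not_adv (h : ¬ Adv v z t p n) : curAt v z t p (n + 1) = v := if_neg h

theorem traceAt_of_adv (h : Adv v z t p n) :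
    traceAt v z t p n = (stateAt v z p n).2 t ++ [p n] := by
  rw [traceAt, curAt_of_adv h]

theorem traceAt_succ_of_adv (h : Adv v z t p n) :
    traceAt v z t p (n + 1) = traceAt v z t p n ++ [p (n + 1)] := by
  rw [traceAt, stateAt_snd_succ_of_adv h, curAt_succ_of_adv h, traceAt_of_adv h]

theorem traceAt_succ_of_not_adv (h : ¬ Adv v z t p n) :
    traceAt v z t p (n + 1) = traceAt v z t p n := by
  rw [traceAt, stateAt_snd_succ_of_not_adv h, curAt_succ_of_not_adv h, traceAt, curAt_of_not_adv h]

theorem traceAt_zero : traceAt v z t p 0 = [if t = false then p 0 else v] := by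
  cases t <;> simp [traceAt, stateAt, projState, hist, curAt]

theorem traceAt_prefix {m : ℕ} (h : m ≤ n) : traceAt v z t p m <+: traceAt v z t p n := by
  induction n, h using Nat.le_induction with
  | base => exact List.prefix_rfl
  | succ n _ ih =>
    by_cases ha : Adv v z t p n
    · rw [traceAt_succ_of_adv ha]
      exact ih.trans (List.prefix_append _ _)
    · rwa [traceAt_succ_of_not_adv ha]

open Classical in
theorem length_traceAt (n : ℕ) :
    (traceAt v z t p n).length = Nat.count (Adv v z t p) n + 1 := by
  induction n with
  | zero => simp [traceAt_zero]
  | succ n ih =>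
    rw [Nat.count_succ]
    split_ifs with ha
    · simp [traceAt_succ_of_adv ha, ih]
    · simp [traceAt_succ_of_not_adv ha, ih]

open Classical in
/-- `q` extends all histories that `p` induces in game `t`. -/
def Follows (v z : V) (t : Bool) (p q : ℕ → V) : Prop :=
  ∀ n, traceAt v z t p n = hist q (Nat.count (Adv v z t p) n + 1)

open Classical in
theorem Follows.of_adv (h : Follows v z t p q) (ha : Adv v z t p n) :
    hist q (Nat.count (Adv v z t p) n) = (stateAt v z p n).2 t ∧
      q (Nat.count (Adv v z t p) n) = p n ∧ q (Nat.count (Adv v z t p) n + 1) = p (n + 1) := by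
  have h1 := h n
  rw [traceAt_of_adv ha, hist_succ] at h1
  obtain ⟨h1, h2⟩ := List.append_inj' h1 rfl
  have h3 := h (n + 1)
  rw [traceAt_succ_of_adv ha, Nat.count_succ, if_pos ha, hist_succ q (_ + 1)] at h3
  obtain ⟨-, h4⟩ := List.append_inj' h3 rfl
  exact ⟨h1.symm, by simpa using h2.symm, by simpa using h4.symm⟩

open Classical in
theorem follows_of_step (h0 : q 0 = if t = false then p 0 else v)
    (hs : ∀ n, Adv v z t p n → hist q (Nat.count (Adv v z t p) n) = (stateAt v z p n).2 t →
      q (Nat.count (Adv v z t p) n) = p n → q (Nat.count (Adv v z t p) n + 1) = p (n + 1)) :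
    Follows v z t p q := by
  intro n
  induction n with
  | zero => simp [traceAt_zero, hist, h0]
  | succ n ih =>
    rw [Nat.count_succ]
    split_ifs with ha
    · rw [traceAt_succ_of_adv ha, ih, hist_succ q (_ + 1), hs n ha]
      all_goals
        rw [traceAt_of_adv ha, hist_succ] at ih
        obtain ⟨h1, h2⟩ := List.append_inj' ih rfl
      · exact h1.symm
      · simpa using h2.symm
    · rw [traceAt_succ_of_not_adv ha, ih, add_zero]

open Classical in
theorem exists_follows (hinf : {n | Adv v z t p n}.Infinite) : ∃ q, Follows v z t p q := by
  have hlen : ∀ k, k < (traceAt v z t p (Nat.nth (Adv v z t p) k)).length := by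
    intro k
    rw [length_traceAt, Nat.count_nth_of_infinite hinf]
    exact Nat.lt_succ_self k
  refine ⟨fun k => (traceAt v z t p (Nat.nth (Adv v z t p) k))[k]'(hlen k), fun n => ?_⟩
  apply List.ext_getElem
  · rw [length_traceAt, length_hist]
  · intro k hk hk'
    simp only [hist, List.getElem_map, List.getElem_range]
    rcases le_total n (Nat.nth (Adv v z t p) k) with hle | hle
    · exact (traceAt_prefix hle).getElem hk
    · exact ((traceAt_prefix hle).getElem (hlen k)).symm

theorem Follows.advOcc_eq (h : Follows v z t p q) (hinf : {n | Adv v z t p n}.Infinite) :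
    advOcc v z t p = InfOcc q := by
  classical
  ext x
  constructor
  · intro hx K
    obtain ⟨n, hn, ha, rfl⟩ := hx (Nat.nth (Adv v z t p) K)
    refine ⟨Nat.count (Adv v z t p) n, ?_, (h.of_adv ha).2.1⟩
    have := Nat.count_monotone (Adv v z t p) hn
    rwa [Nat.count_nth_of_infinite hinf] at this
  · intro hx N
    obtain ⟨k, hk, rfl⟩ := hx (Nat.count (Adv v z t p) N)
    have ha : Adv v z t p (Nat.nth (Adv v z t p) k) := Nat.nth_mem_of_infinite hinf k
    refine ⟨_, ?_, ha, ?_⟩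
    · exact (Nat.count_le_iff_le_nth hinf).1 hk
    · rw [← (h.of_adv ha).2.1, Nat.count_nth_of_infinite hinf]

theorem advOcc_eq_empty (hfin : ¬ {n | Adv v z t p n}.Infinite) : advOcc v z t p = ∅ := by
  refine Set.eq_empty_of_forall_notMem fun x hx => hfin ?_
  refine Set.infinite_of_forall_exists_gt fun N => ?_
  obtain ⟨n, hn, ha, -⟩ := hx (N + 1)
  exact ⟨n, ha, hn⟩

theorem Follows.even_advOcc {f : V → ℕ} (h : Follows v z t p q) (hq : q ∈ ParityWin f) :
    Even (sInf (f '' advOcc v z t p)) := by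
  by_cases hinf : {n | Adv v z t p n}.Infinite
  · rw [h.advOcc_eq hinf]
    exact hq
  · simp [advOcc_eq_empty hinf]

theorem infOcc_eq_union : InfOcc p = advOcc v z false p ∪ advOcc v z true p := by
  ext x
  constructor
  · intro hx
    by_contra hn
    simp only [Set.mem_union, advOcc, Set.mem_ofPred_eq] at hn
    push Not at hn
    obtain ⟨⟨N, hN⟩, M, hM⟩ := hn
    obtain ⟨n, hn, rfl⟩ := hx (max N M)
    cases ht : (stateAt v z p (n + 1)).1
    · exact hN n (le_of_max_le_left hn) ht rfl
    · exact hM n (le_of_max_le_right hn) ht rfl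
  · rintro (hx | hx) N
    all_goals
      obtain ⟨n, hn, -, rfl⟩ := hx N
      exact ⟨n, hn, rfl⟩

theorem mem_parityWin_of_even_advOcc {f : V → ℕ}
    (h : ∀ t, Even (sInf (f '' advOcc v z t p))) : p ∈ ParityWin f := by
  change Even (sInf (f '' InfOcc p))
  rcases (f '' InfOcc p).eq_empty_or_nonempty with he | hne
  · simp [he]
  have key : ∀ t, sInf (f '' InfOcc p) ∈ f '' advOcc v z t p → Even (sInf (f '' InfOcc p)) := by
    intro t ht
    have hsub : advOcc v z t p ⊆ InfOcc p := by
      rw [infOcc_eq_union (v := v) (z := z)]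
      cases t
      · exact Set.subset_union_left
      · exact Set.subset_union_right
    have : sInf (f '' InfOcc p) = sInf (f '' advOcc v z t p) :=
      le_antisymm (csInf_le_csInf (OrderBot.bddBelow _) ⟨_, ht⟩ (Set.image_mono hsub))
        (Nat.sInf_le ht)
    rw [this]
    exact h t
  obtain ⟨x, hx, hfx⟩ := Nat.sInf_mem hne
  rw [infOcc_eq_union (v := v) (z := z)] at hx
  rcases hx with hx | hx
  · exact key false ⟨x, hx, hfx⟩
  · exact key true ⟨x, hx, hfx⟩

theorem measurableSet_even_advOcc [MeasurableSpace V] [DiscreteMeasurableSpace V] (f : V → ℕ) :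
    MeasurableSet {p : ℕ → V | Even (sInf (f '' advOcc v z t p))} := by
  refine measurableSet_infinitelyOften (D := fun n x => {p : ℕ → V | Adv v z t p n ∧ p n = x})
    (fun n x => ?_) fun A => Even (sInf (f '' A))
  have : {p : ℕ → V | Adv v z t p n ∧ p n = x} = {p | ∃ q, hist p (n + 2) = hist q (n + 2) ∧
      Adv v z t q n ∧ q n = x} := by
    ext p
    constructor
    · exact fun h => ⟨p, rfl, h⟩
    · rintro ⟨q, hpq, ha, rfl⟩
      have hi : ∀ i < n + 2, p i = q i := by
        intro i hi
        have := List.getElem_of_eq hpq (i := i) (by simpa [length_hist] using hi)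
        simpa [hist] using this
      refine ⟨?_, hi n (by omega)⟩
      rw [Adv, stateAt_congr fun i h => hi i (by omega)]
      exact ha
  rw [this]
  exact measurableSet_hist (n + 2) fun l => ∃ q, l = hist q (n + 2) ∧ Adv v z t q n ∧ q n = x

end Projection

/-- The strategy that plays `σs t` on the past of game `t`, where `t` is the selected game. -/
noncomputable def compStrat (v z : V) (σs : Bool → Strat V) : Strat V := fun l x =>
  let S := projState v z l.reverse x
  σs S.1 (S.2 S.1) x

theorem compStrat_hist {v z : V} {p : ℕ → V} {n : ℕ} {t : Bool} (σs : Bool → Strat V)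
    (h : (stateAt v z p n).1 = t) :
    compStrat v z σs (hist p n) (p n) = σs t ((stateAt v z p n).2 t) (p n) := by
  subst h; rfl

theorem Follows.zero {v z : V} {t : Bool} {p q : ℕ → V} (h : Follows v z t p q) :
    q 0 = if t = false then p 0 else v := by
  have := h 0
  simpa [traceAt_zero, hist] using this.symm

section Composition

variable {G : SASGame V} {Gs : Bool → SASGame V} {u v : V} {w : Bool → V} {t : Bool}
  {σs ρ ρ' : Bool → Strat V} {π : Strat V}

theorem eq_of_adv {p : ℕ → V} {n : ℕ}
    (hsucc : ∀ y, G.E v y ↔ y = w false ∨ y = w true) (hn : p n = v) (hE : G.E (p n) (p (n + 1)))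
    (ha : Adv v (w true) t p n) : p (n + 1) = w t := by
  rw [adv_iff_of_eq hn] at ha
  rw [hn, hsucc] at hE
  cases t
  · exact hE.resolve_right fun h => by simpa using ha.1 h
  · exact ha.2 rfl

theorem Follows.mem_playsFrom (hv : v ∈ G.V1) (hne : w false ≠ w true)
    (hsucc : ∀ y, G.E v y ↔ y = w false ∨ y = w true)
    (hG : ∀ t, EdgeRemoved G (Gs t) v (w !t)) {p q : ℕ → V}
    (hp : p ∈ G.PlaysFrom u (compStrat v (w true) σs)) (h : Follows v (w true) t p q)
    (hinf : {n | Adv v (w true) t p n}.Infinite) :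
    q ∈ (Gs t).PlaysFrom (if t = false then u else v) (σs t) := by
  classical
  obtain ⟨rfl, hE, h0⟩ := hp
  have hstep : ∀ k, ∃ n, Adv v (w true) t p n ∧ hist q k = (stateAt v (w true) p n).2 t ∧
      q k = p n ∧ q (k + 1) = p (n + 1) := by
    intro k
    have ha : Adv v (w true) t p (Nat.nth (Adv v (w true) t p) k) := Nat.nth_mem_of_infinite hinf k
    have := h.of_adv ha
    rw [Nat.count_nth_of_infinite hinf] at this
    exact ⟨_, ha, this⟩
  refine ⟨h.zero, fun k => ?_, fun k hk => ?_⟩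
  · obtain ⟨n, ha, -, h1, h2⟩ := hstep k
    rw [h1, h2, (hG t).E_iff]
    refine ⟨hE n, fun ⟨hn, hn'⟩ => ?_⟩
    have := (eq_of_adv hsucc hn (hE n) ha).symm.trans hn'
    cases t
    · exact hne this
    · exact hne this.symm
  · obtain ⟨n, ha, hh, h1, h2⟩ := hstep k
    rw [h1, (hG t).V0_eq] at hk
    have hn : p n ≠ v := fun hn => G.disj01.notMem_of_mem_left hk (hn ▸ hv)
    rw [hh, h1, h2, h0 n hk, compStrat_hist σs ((adv_iff_of_ne hn).1 ha)]

/-- The play in which both the moves of Player 0 and the random moves are composed. -/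
noncomputable def compPlay (G : SASGame V) (u v z : V) (σs : Bool → Strat V) (π : Strat V)
    (ρ : Bool → Strat V) : ℕ → V :=
  playOf (G.move (compStrat v z σs) π (compStrat v z ρ)) u

theorem compPlay_congr_of_traceAt (hv : v ∈ G.V1) {z : V} {n n' : ℕ} (hρ : ρ (!t) = ρ' (!t))
    (h : traceAt v z t (compPlay G u v z σs π ρ) n = traceAt v z t (compPlay G u v z σs π ρ') n') :
    ∀ i, i ≤ n → i ≤ n' → compPlay G u v z σs π ρ i = compPlay G u v z σs π ρ' i := by
  set p := compPlay G u v z σs π ρ with hp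
  set p' := compPlay G u v z σs π ρ' with hp'
  intro i
  induction i using Nat.strong_induction_on with
  | _ i ih =>
    intro hi hi'
    cases i with
    | zero => rfl
    | succ i =>
      have hS : stateAt v z p i = stateAt v z p' i :=
        stateAt_congr fun j hj => ih j (by omega) (by omega) (by omega)
      have hh : hist p i = hist p' i :=
        hist_congr fun j hj => ih j (by omega) (by omega) (by omega)
      have hx : p i = p' i := ih i (by omega) (by omega) (by omega)
      have e : p (i + 1) = G.move (compStrat v z σs) π (compStrat v z ρ) (hist p i) (p i) :=
        playOf_succ _ _ _
      have e' : p' (i + 1) = G.move (compStrat v z σs) π (compStrat v z ρ') (hist p' i) (p' i) :=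
        playOf_succ _ _ _
      by_cases h0 : p i ∈ G.V0
      · rw [e, e', ← hh, ← hx]
        simp only [SASGame.move, if_pos h0]
      by_cases h1 : p i ∈ G.V1
      · rw [e, e', ← hh, ← hx]
        simp only [SASGame.move, if_neg h0, if_pos h1]
      have hn : p i ≠ v := fun hn => h1 (hn ▸ hv)
      by_cases hm : (stateAt v z p i).1 = t
      · have ha := (adv_iff_of_ne hn).2 hm
        have ha' := (adv_iff_of_ne (hx ▸ hn)).2 (hS ▸ hm)
        have h2 := traceAt_prefix (v := v) (z := z) (t := t) (p := p) hi
        have h2' := traceAt_prefix (v := v) (z := z) (t := t) (p := p') hi'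
        rw [← h] at h2'
        rw [traceAt_succ_of_adv ha] at h2
        rw [traceAt_succ_of_adv ha'] at h2'
        have hT : traceAt v z t p i = traceAt v z t p' i := by
          rw [traceAt_of_adv ha, traceAt_of_adv ha', hS, hx]
        have := (List.prefix_of_prefix_length_le h2 h2' (by simp [hT])).eq_of_length (by simp [hT])
        simpa [hT] using this
      · have hm' : (stateAt v z p i).1 = !t := by simpa [Bool.eq_not] using hm
        rw [e, e', ← hh, ← hx]
        simp only [SASGame.move, if_neg h0, if_neg h1]
        rw [compStrat_hist ρ hm', compStrat_hist ρ' hm', hρ]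

theorem hist_compPlay_eq (hv : v ∈ G.V1) {z : V} {n n' : ℕ} (hρ : ρ (!t) = ρ' (!t))
    (hn : compPlay G u v z σs π ρ n ≠ v)
    (hx : compPlay G u v z σs π ρ n = compPlay G u v z σs π ρ' n')
    (hm : (stateAt v z (compPlay G u v z σs π ρ) n).1 = t)
    (hm' : (stateAt v z (compPlay G u v z σs π ρ') n').1 = t)
    (hS : (stateAt v z (compPlay G u v z σs π ρ) n).2 t =
      (stateAt v z (compPlay G u v z σs π ρ') n').2 t) :
    hist (compPlay G u v z σs π ρ) n = hist (compPlay G u v z σs π ρ') n' := by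
  wlog hle : n ≤ n' generalizing n n' ρ ρ'
  · exact (this hρ.symm (hx ▸ hn) hx.symm hm' hm hS.symm (by omega)).symm
  have hT : traceAt v z t (compPlay G u v z σs π ρ) n =
      traceAt v z t (compPlay G u v z σs π ρ') n' := by
    rw [traceAt_of_adv ((adv_iff_of_ne hn).2 hm), traceAt_of_adv ((adv_iff_of_ne (hx ▸ hn)).2 hm'),
      hS, hx]
  have hag := compPlay_congr_of_traceAt hv hρ hT
  rcases hle.eq_or_lt with rfl | hlt
  · exact hist_congr fun i hi => hag i hi.le hi.le
  · exfalso
    have hst := stateAt_congr (v := v) (z := z) fun i (hi : i ≤ n) => hag i hi (by omega)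
    have hx' := hag n le_rfl hle
    have ha := (adv_iff_of_ne (p := compPlay G u v z σs π ρ) hn).2 hm
    have ha' := (adv_iff_of_ne (p := compPlay G u v z σs π ρ') (n := n) (hx' ▸ hn)).2 (hst ▸ hm)
    have hl := (traceAt_prefix (v := v) (z := z) (t := t) (p := compPlay G u v z σs π ρ')
      (Nat.succ_le_of_lt hlt)).length_le
    rw [Nat.succ_eq_add_one, traceAt_succ_of_adv ha', ← hT, traceAt_of_adv ha, traceAt_of_adv ha',
      hst, hx'] at hl
    simp at hl

open Classical in
/-- The Player-1 strategy in game `t` that reconstructs the history of the composed play, given the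
random moves `η` of the other game, and then plays `π`. -/
noncomputable def counterStrat (G : SASGame V) (u v : V) (w : Bool → V) (σs : Bool → Strat V)
    (π : Strat V) (t : Bool) (η : Strat V) : Strat V := fun l x =>
  if x = v then w t else
    π (if h : ∃ l', ∃ (ρ : Bool → Strat V) (n : ℕ), ρ (!t) = η ∧
          (stateAt v (w true) (compPlay G u v (w true) σs π ρ) n).1 = t ∧
          (stateAt v (w true) (compPlay G u v (w true) σs π ρ) n).2 t = l ∧
          compPlay G u v (w true) σs π ρ n = x ∧ hist (compPlay G u v (w true) σs π ρ) n = l'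
      then h.choose else []) x

theorem counterStrat_of_ne (hv : v ∈ G.V1) {n : ℕ}
    (hm : (stateAt v (w true) (compPlay G u v (w true) σs π ρ) n).1 = t)
    (hn : compPlay G u v (w true) σs π ρ n ≠ v) :
    counterStrat G u v w σs π t (ρ (!t))
        ((stateAt v (w true) (compPlay G u v (w true) σs π ρ) n).2 t)
        (compPlay G u v (w true) σs π ρ n) =
      π (hist (compPlay G u v (w true) σs π ρ) n) (compPlay G u v (w true) σs π ρ n) := by
  have hex : ∃ l', ∃ (ρ' : Bool → Strat V) (n' : ℕ), ρ' (!t) = ρ (!t) ∧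
      (stateAt v (w true) (compPlay G u v (w true) σs π ρ') n').1 = t ∧
      (stateAt v (w true) (compPlay G u v (w true) σs π ρ') n').2 t =
        (stateAt v (w true) (compPlay G u v (w true) σs π ρ) n).2 t ∧
      compPlay G u v (w true) σs π ρ' n' = compPlay G u v (w true) σs π ρ n ∧
      hist (compPlay G u v (w true) σs π ρ') n' = l' :=
    ⟨_, ρ, n, rfl, hm, rfl, rfl, rfl⟩
  rw [counterStrat, if_neg hn, dif_pos hex]
  obtain ⟨ρ', n', h1, h2, h3, h4, h5⟩ := hex.choose_spec
  rw [← h5, hist_compPlay_eq hv h1 (h4 ▸ hn) h4 h2 hm h3]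

theorem valid1_counterStrat (hne : w false ≠ w true)
    (hsucc : ∀ y, G.E v y ↔ y = w false ∨ y = w true)
    (hG : ∀ t, EdgeRemoved G (Gs t) v (w !t)) (hπ : G.Valid1 π) (η : Strat V) :
    (Gs t).Valid1 (counterStrat G u v w σs π t η) := by
  intro l x hx
  rw [(hG t).V1_eq] at hx
  by_cases h : x = v
  · rw [counterStrat, if_pos h, (hG t).E_iff, h, hsucc]
    cases t <;> simp [hne, hne.symm]
  · rw [(hG t).E_iff_of_ne h, counterStrat, if_neg h]
    exact hπ _ _ hx

theorem follows_compPlay (hv : v ∈ G.V1)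
    (hsucc : ∀ y, G.E v y ↔ y = w false ∨ y = w true)
    (hG : ∀ t, EdgeRemoved G (Gs t) v (w !t)) (hπ : G.Valid1 π) :
    Follows v (w true) t (compPlay G u v (w true) σs π ρ)
      (playOf ((Gs t).move (σs t) (counterStrat G u v w σs π t (ρ (!t))) (ρ t))
        (if t = false then u else v)) := by
  have hv0 : v ∉ G.V0 := G.disj01.notMem_of_mem_right hv
  refine follows_of_step rfl fun n ha hh hx => ?_
  rw [playOf_succ, hh, hx, (hG t).move_eq]
  have hp := playOf_succ (G.move (compStrat v (w true) σs) π (compStrat v (w true) ρ)) u n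
  change compPlay G u v (w true) σs π ρ (n + 1) =
    G.move _ _ _ (hist (compPlay G u v (w true) σs π ρ) n) (compPlay G u v (w true) σs π ρ n) at hp
  by_cases hn : compPlay G u v (w true) σs π ρ n = v
  · have hE : G.E (compPlay G u v (w true) σs π ρ n) (compPlay G u v (w true) σs π ρ (n + 1)) := by
      rw [hp, hn]
      simp only [SASGame.move, if_neg hv0, if_pos hv]
      exact hπ _ _ hv
    rw [eq_of_adv hsucc hn hE ha, hn]
    simp [SASGame.move, if_neg hv0, if_pos hv, counterStrat]
  · have hm := (adv_iff_of_ne hn).1 ha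
    rw [hp]
    unfold SASGame.move
    rw [compStrat_hist σs hm, compStrat_hist ρ hm, counterStrat_of_ne hv hm hn]

section Sampling

variable [MeasurableSpace V] [DiscreteMeasurableSpace V]

theorem ae_even_advOcc_compPlay (hv : v ∈ G.V1) (hne : w false ≠ w true)
    (hsucc : ∀ y, G.E v y ↔ y = w false ∨ y = w true)
    (hG : ∀ t, EdgeRemoved G (Gs t) v (w !t)) (hπ : G.Valid1 π)
    (hw : (Gs t).Wins0Via (if t = false then u else v) (σs t)) (η : Strat V) :
    ∀ᵐ ξ ∂sampleMeasure G.κ, ∀ ρ : Bool → Strat V, ρ (!t) = η → (ρ t = fun l x => ξ (l, x)) →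
      Even (sInf (G.pas '' advOcc v (w true) t (compPlay G u v (w true) σs π ρ))) := by
  have h := ((Gs t).forall_isPlayMeasure_iff _ _ _).1
    (hw.2.2 _ (valid1_counterStrat (u := u) (σs := σs) hne hsucc hG hπ η))
  rw [(hG t).κ_eq, (hG t).pas_eq] at h
  filter_upwards [h] with ξ hξ ρ hη hρ
  refine (follows_compPlay hv hsucc hG hπ).even_advOcc ?_
  rwa [hη, hρ]

theorem isSampler_prod (κ : V → V → ENNReal) :
    IsSampler κ ((sampleMeasure κ).prod (sampleMeasure κ)) (fun i : Bool × (List V × V) => i.2.2)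
      fun i ω => cond i.1 ω.2 ω.1 i.2 := by
  classical
  refine ⟨?_, fun S c => ?_⟩
  · rintro ⟨_ | _, i⟩
    · exact (measurable_pi_apply i).comp measurable_fst
    · exact (measurable_pi_apply i).comp measurable_snd
  let T : Bool → Finset (List V × V) := fun t => (S.filter (·.1 = t)).image Prod.snd
  have hT : ∀ t, ∏ s ∈ S.filter (·.1 = t), transLaw κ s.2.2 (c s) =
      sampleMeasure κ {ω | ∀ i ∈ T t, ω i = c (t, i)} := by
    intro t
    rw [(isSampler_sampleMeasure κ).2 (T t) fun i => c (t, i), Finset.prod_image]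
    · refine Finset.prod_congr rfl fun s hs => ?_
      rw [← (Finset.mem_filter.1 hs).2]
    · rintro ⟨a, i⟩ ha ⟨b, j⟩ hb rfl
      simp only [Finset.coe_filter, Set.mem_ofPred_eq] at ha hb
      rw [ha.2, hb.2]
  have hset : {ω : (List V × V → V) × (List V × V → V) | ∀ s ∈ S, cond s.1 ω.2 ω.1 s.2 = c s} =
      {ω | ∀ i ∈ T false, ω i = c (false, i)} ×ˢ {ω | ∀ i ∈ T true, ω i = c (true, i)} := by
    ext ω
    simp [T]
  rw [hset, Measure.prod_prod, ← hT, ← hT, ← Finset.prod_filter_mul_prod_filter_not S (·.1 = false)]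
  simp

end Sampling

theorem wins0Via_compStrat (hv : v ∈ G.V1) (hne : w false ≠ w true)
    (hsucc : ∀ y, G.E v y ↔ y = w false ∨ y = w true)
    (hG : ∀ t, EdgeRemoved G (Gs t) v (w !t))
    (hw : ∀ t, (Gs t).Wins0Via (if t = false then u else v) (σs t)) :
    G.Wins0Via u (compStrat v (w true) σs) := by
  refine ⟨fun l x hx => ?_, fun p hp => ?_, fun π hπ => ?_⟩
  · have := (hw (projState v (w true) l.reverse x).1).1
      ((projState v (w true) l.reverse x).2 (projState v (w true) l.reverse x).1) x
      ((hG _).V0_eq ▸ hx)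
    exact (((hG _).E_iff _ _).1 this).1
  · refine mem_parityWin_of_even_advOcc (v := v) (z := w true) fun t => ?_
    by_cases hinf : {n | Adv v (w true) t p n}.Infinite
    · obtain ⟨q, hq⟩ := exists_follows hinf
      exact hq.even_advOcc ((hG t).ps_eq ▸ (hw t).2.1 (hq.mem_playsFrom hv hne hsucc hG hp hinf))
    · simp [advOcc_eq_empty hinf]
  let _ : MeasurableSpace V := ⊤
  let J : List V → V → Bool × (List V × V) := fun l x =>
    ((projState v (w true) l.reverse x).1, ((projState v (w true) l.reverse x).2
      (projState v (w true) l.reverse x).1, x))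
  have hJ : ∀ p n, J (hist p n) (p n) = ((stateAt v (w true) p n).1,
    ((stateAt v (w true) p n).2 (stateAt v (w true) p n).1, p n)) := fun _ _ => rfl
  refine ((isSampler_prod G.κ).forall_isPlayMeasure_iff G (J := J) (fun _ _ _ => rfl)
    (fun p m n hmn hm hn h => ?_) u _ π).2 ?_
  · simp only [hJ, Prod.mk.injEq] at h
    obtain ⟨h1, h2, h3⟩ := h
    have hpm : p m ≠ v := fun h => G.disj1p.notMem_of_mem_left hv (h ▸ hm)
    have ha := (adv_iff_of_ne (z := w true) hpm).2 rfl
    have ha' := (adv_iff_of_ne (z := w true) (h3 ▸ hpm : p n ≠ v)).2 rfl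
    rw [← h1] at ha' h2
    have hl := (traceAt_prefix (v := v) (z := w true) (t := (stateAt v (w true) p m).1) (p := p)
      (Nat.succ_le_of_lt hmn)).length_le
    rw [Nat.succ_eq_add_one, traceAt_succ_of_adv ha, traceAt_of_adv ha, traceAt_of_adv ha', h2]
      at hl
    simp at hl
  have hmeas : ∀ t, MeasurableSet {ω : (List V × V → V) × (List V × V → V) |
      Even (sInf (G.pas '' advOcc v (w true) t (compPlay G u v (w true) σs π
        fun t l x => (cond t ω.2 ω.1 : List V × V → V) (l, x))))} := fun t =>
    measurable_playOf_move G (isSampler_prod G.κ) J u (compStrat v (w true) σs) π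
      (measurableSet_even_advOcc G.pas)
  have key : ∀ t, ∀ᵐ ω ∂(sampleMeasure G.κ).prod (sampleMeasure G.κ),
      Even (sInf (G.pas '' advOcc v (w true) t (compPlay G u v (w true) σs π
        fun t l x => (cond t ω.2 ω.1 : List V × V → V) (l, x)))) := by
    intro t
    rw [Measure.ae_prod_iff_ae_ae (hmeas t)]
    cases t
    · rw [Measure.ae_ae_comm (hmeas false)]
      refine .of_forall fun η => ?_
      filter_upwards [ae_even_advOcc_compPlay hv hne hsucc hG hπ (hw false)
        fun l x => η (l, x)] with ξ hξ
      exact hξ _ rfl rfl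
    · refine .of_forall fun η => ?_
      filter_upwards [ae_even_advOcc_compPlay hv hne hsucc hG hπ (hw true)
        fun l x => η (l, x)] with ξ hξ
      exact hξ _ rfl rfl
  filter_upwards [key false, key true] with ω h0 h1
  exact mem_parityWin_of_even_advOcc (v := v) (z := w true) (Bool.forall_bool.2 ⟨h0, h1⟩)

end Composition

/-- Strategy composition under edge removal: let `G` be a finite
SAS parity game, `v ∈ V1` a Player-1 configuration with exactly two successors
`va` and `vb`, `Ga` the game `G` with the edge `(v, vb)` removed and `Gb` the game
`G` with the edge `(v, va)` removed. If Player 0 wins from `u` in `Ga` and from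
`u` in `Gb`, then Player 0 wins from `u` in `G`. -/
theorem sas_compose_edge_removal (G Ga Gb : SASGame V) (v va vb u : V)
    (hv : v ∈ G.V1) (hne : va ≠ vb)
    (hsucc : ∀ w, G.E v w ↔ (w = va ∨ w = vb))
    (haV0 : Ga.V0 = G.V0) (haV1 : Ga.V1 = G.V1) (haVp : Ga.Vp = G.Vp)
    (haκ : Ga.κ = G.κ) (haps : Ga.ps = G.ps) (hapas : Ga.pas = G.pas)
    (haE : Ga.E = fun x y => G.E x y ∧ ¬(x = v ∧ y = vb))
    (hbV0 : Gb.V0 = G.V0) (hbV1 : Gb.V1 = G.V1) (hbVp : Gb.Vp = G.Vp)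
    (hbκ : Gb.κ = G.κ) (hbps : Gb.ps = G.ps) (hbpas : Gb.pas = G.pas)
    (hbE : Gb.E = fun x y => G.E x y ∧ ¬(x = v ∧ y = va))
    (ha : Ga.Wins0 u) (hb : Gb.Wins0 u) :
    G.Wins0 u := by
  have hA : EdgeRemoved G Ga v vb :=
    ⟨haV0, haV1, haκ, haps, hapas, fun x y => by rw [haE]⟩
  have hB : EdgeRemoved G Gb v va :=
    ⟨hbV0, hbV1, hbκ, hbps, hbpas, fun x y => by rw [hbE]⟩
  obtain ⟨σa, ha⟩ := ha
  obtain ⟨σb, hb⟩ := hb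
  by_cases hr : ∃ τ, Gb.Reaches u σb v τ
  · obtain ⟨τ, hτ⟩ := hr
    exact ⟨_, wins0Via_compStrat (Gs := fun t => cond t Gb Ga) (w := fun t => cond t vb va)
      (σs := fun t => cond t τ σa) hv hne hsucc (Bool.forall_bool.2 ⟨hA, hB⟩)
      (Bool.forall_bool.2 ⟨ha, hτ.wins0Via hb⟩)⟩
  · exact ⟨σb, hB.wins0Via_of_not_reaches hb (not_exists.1 hr)⟩
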